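/- arXiv:2407.18835 — 2 statements merged into one kernel-verified Lean document; each statement's English description precedes it below -/
import Mathlib

section
/- For all fixed u, v ∈ ℝ, the map ρ ↦ Φ₂(u,v;ρ) is strictly increasing on the interval (-1,1). -/
open MeasureTheory Real

/-- Density of the standard bivariate normal distribution with correlation `ρ`. -/
noncomputable def phi2 (u v ρ : ℝ) : ℝ :=
  (2 * Real.pi * Real.sqrt (1 - ρ ^ 2))⁻¹ *
    Real.exp (-(u ^ 2 - 2 * ρ * u * v + v ^ 2) / (2 * (1 - ρ ^ 2)))

/-- Distribution function of the standard bivariate normal distribution with correlation `ρ`. -/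
noncomputable def Phi2 (u v ρ : ℝ) : ℝ := ∫ s in Set.Iic u, ∫ t in Set.Iic v, phi2 s t ρ

open Filter Topology Set

/-- The unnormalised standard Gaussian density. -/
noncomputable def gaussKernel (x : ℝ) : ℝ := Real.exp (-(1 / 2) * x ^ 2)

/-- The unnormalised standard Gaussian distribution function. -/
noncomputable def gaussCDF (x : ℝ) : ℝ := ∫ t in Iic x, gaussKernel t

lemma integrable_gaussKernel : Integrable gaussKernel :=
  integrable_exp_neg_mul_sq (by norm_num)

lemma integrable_abs_mul_gaussKernel : Integrable fun x => |x| * gaussKernel x := by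
  refine (integrable_mul_exp_neg_mul_sq (b := 1 / 2) (by norm_num)).abs.congr
    (Eventually.of_forall fun x => ?_)
  simp [gaussKernel, abs_mul, Real.abs_exp]

lemma continuous_gaussKernel : Continuous gaussKernel := by
  unfold gaussKernel; fun_prop

lemma gaussKernel_nonneg (x : ℝ) : 0 ≤ gaussKernel x := (Real.exp_pos _).le

lemma gaussKernel_le_one (x : ℝ) : gaussKernel x ≤ 1 := by
  rw [gaussKernel, Real.exp_le_one_iff]
  nlinarith [sq_nonneg x]

lemma tendsto_gaussKernel_atBot : Tendsto gaussKernel atBot (𝓝 0) := by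
  refine Real.tendsto_exp_atBot.comp (Tendsto.const_mul_atTop_of_neg (by norm_num) ?_)
  simpa [pow_two] using tendsto_id.atBot_mul_atBot₀ (tendsto_id (α := ℝ))

lemma hasDerivAt_gaussCDF (x : ℝ) : HasDerivAt gaussCDF (gaussKernel x) x := by
  have h : gaussCDF = fun y => (∫ t in (0 : ℝ)..y, gaussKernel t) + gaussCDF 0 := by
    ext y
    rw [← intervalIntegral.integral_Iic_sub_Iic integrable_gaussKernel.integrableOn
      integrable_gaussKernel.integrableOn, gaussCDF, gaussCDF]
    ring
  rw [h]
  exact (continuous_gaussKernel.integral_hasStrictDerivAt 0 x).hasDerivAt.add_const _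

lemma continuous_gaussCDF : Continuous gaussCDF :=
  continuous_iff_continuousAt.2 fun x => (hasDerivAt_gaussCDF x).continuousAt

lemma gaussCDF_nonneg (x : ℝ) : 0 ≤ gaussCDF x :=
  setIntegral_nonneg measurableSet_Iic fun t _ => gaussKernel_nonneg t

lemma gaussCDF_le (x : ℝ) : gaussCDF x ≤ ∫ t, gaussKernel t :=
  setIntegral_le_integral integrable_gaussKernel (Eventually.of_forall gaussKernel_nonneg)

lemma phi2_comm (s t ρ : ℝ) : phi2 s t ρ = phi2 t s ρ := by
  unfold phi2
  congr 3
  ring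

lemma phi2_pos {ρ : ℝ} (hρ : 0 < 1 - ρ ^ 2) (s t : ℝ) : 0 < phi2 s t ρ := by
  have := Real.sqrt_pos.2 hρ
  unfold phi2
  positivity

/-- Factorisation into the marginal density and the conditional density. -/
lemma phi2_eq_marginal_mul_conditional {ρ : ℝ} (hρ : 0 < 1 - ρ ^ 2) (s t : ℝ) :
    phi2 s t ρ = (2 * Real.pi)⁻¹ * gaussKernel s *
      (gaussKernel ((t - ρ * s) / √(1 - ρ ^ 2)) * (√(1 - ρ ^ 2))⁻¹) := by
  have hexp : Real.exp (-(s ^ 2 - 2 * ρ * s * t + t ^ 2) / (2 * (1 - ρ ^ 2))) =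
      gaussKernel s * gaussKernel ((t - ρ * s) / √(1 - ρ ^ 2)) := by
    rw [gaussKernel, gaussKernel, ← Real.exp_add, div_pow, Real.sq_sqrt hρ.le]
    congr 1
    have := hρ.ne'
    field_simp
    ring
  rw [phi2, hexp, mul_inv]
  ring

lemma integral_Iic_phi2 {ρ : ℝ} (hρ : 0 < 1 - ρ ^ 2) (s v : ℝ) :
    ∫ t in Iic v, phi2 s t ρ =
      (2 * Real.pi)⁻¹ * gaussKernel s * gaussCDF ((v - ρ * s) / √(1 - ρ ^ 2)) := by
  have hk := Real.sqrt_pos.2 hρ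
  simp_rw [phi2_eq_marginal_mul_conditional hρ]
  rw [integral_const_mul]
  congr 1
  have hlim : Tendsto (fun t => (t - ρ * s) / √(1 - ρ ^ 2)) atBot atBot :=
    (tendsto_atBot_add_const_right _ (-(ρ * s)) tendsto_id).atBot_div_const hk
  rw [integral_Iic_of_hasDerivAt_of_tendsto'
    (f := fun t => gaussCDF ((t - ρ * s) / √(1 - ρ ^ 2))) (m := 0), sub_zero]
  · intro t _
    have h := (hasDerivAt_gaussCDF ((t - ρ * s) / √(1 - ρ ^ 2))).comp t
      (((hasDerivAt_id t).sub_const (ρ * s)).div_const √(1 - ρ ^ 2))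
    rw [one_div] at h
    exact h
  · exact (((integrable_gaussKernel.comp_div hk.ne').comp_sub_right (ρ * s)).mul_const
      _).integrableOn
  · exact tendsto_integral_Iic_zero hlim

lemma hasDerivAt_phi2_left {ρ : ℝ} (hρ : 0 < 1 - ρ ^ 2) (s t : ℝ) :
    HasDerivAt (fun x => phi2 x t ρ) (phi2 s t ρ * ((ρ * t - s) / (1 - ρ ^ 2))) s := by
  have h : HasDerivAt (fun x : ℝ => -(x ^ 2 - 2 * ρ * x * t + t ^ 2) / (2 * (1 - ρ ^ 2)))
      (-(2 * s - 2 * ρ * t) / (2 * (1 - ρ ^ 2))) s := by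
    have := ((((hasDerivAt_pow 2 s).sub
      (((hasDerivAt_id s).const_mul (2 * ρ)).mul_const t)).add_const (t ^ 2)).neg).div_const
        (2 * (1 - ρ ^ 2))
    simpa using this
  convert! h.exp.const_mul ((2 * Real.pi * √(1 - ρ ^ 2))⁻¹) using 1
  rw [phi2, mul_assoc]
  congr 2
  have := hρ.ne'
  field_simp
  ring

lemma tendsto_phi2_left_atBot {ρ : ℝ} (hρ : 0 < 1 - ρ ^ 2) (t : ℝ) :
    Tendsto (fun s => phi2 s t ρ) atBot (𝓝 0) := by
  simp_rw [fun s => phi2_comm s t ρ, phi2_eq_marginal_mul_conditional hρ]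
  have hlim : Tendsto (fun s => (s - ρ * t) / √(1 - ρ ^ 2)) atBot atBot :=
    (tendsto_atBot_add_const_right _ (-(ρ * t)) tendsto_id).atBot_div_const
      (Real.sqrt_pos.2 hρ)
  simpa using ((tendsto_gaussKernel_atBot.comp hlim).mul_const
    (√(1 - ρ ^ 2))⁻¹).const_mul ((2 * Real.pi)⁻¹ * gaussKernel t)

lemma hasDerivAt_marginal_mul_gaussCDF {ρ : ℝ} (hρ : 0 < 1 - ρ ^ 2) (s v : ℝ) :
    HasDerivAt
      (fun r => (2 * Real.pi)⁻¹ * gaussKernel s * gaussCDF ((v - r * s) / √(1 - r ^ 2)))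
      (phi2 s v ρ * ((ρ * v - s) / (1 - ρ ^ 2))) ρ := by
  have hk := Real.sqrt_pos.2 hρ
  have hsq := Real.sq_sqrt hρ.le
  have hsqrt : HasDerivAt (fun r : ℝ => √(1 - r ^ 2)) (-(2 * ρ) / (2 * √(1 - ρ ^ 2))) ρ := by
    have := ((hasDerivAt_pow 2 ρ).const_sub 1).sqrt hρ.ne'
    simpa using this
  have hlin : HasDerivAt (fun r : ℝ => v - r * s) (-s) ρ := by
    simpa using ((hasDerivAt_id ρ).mul_const s).const_sub v
  have h := ((hasDerivAt_gaussCDF ((v - ρ * s) / √(1 - ρ ^ 2))).comp ρ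
    (hlin.div hsqrt hk.ne')).const_mul ((2 * Real.pi)⁻¹ * gaussKernel s)
  convert! h using 1
  rw [phi2_eq_marginal_mul_conditional hρ]
  generalize gaussKernel ((v - ρ * s) / √(1 - ρ ^ 2)) = g
  rw [mul_assoc ((2 * Real.pi)⁻¹ * gaussKernel s), mul_assoc g]
  congr 2
  rw [hsq]
  field_simp
  rw [hsq]
  ring

lemma abs_phi2_mul_le {ρ m : ℝ} (hm : 0 < m) (hρ : m ≤ 1 - ρ ^ 2) (s v : ℝ) :
    |phi2 s v ρ * ((ρ * v - s) / (1 - ρ ^ 2))| ≤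
      (2 * Real.pi)⁻¹ * (√m)⁻¹ * m⁻¹ * (|v| * gaussKernel s + |s| * gaussKernel s) := by
  have hρ0 : 0 < 1 - ρ ^ 2 := hm.trans_le hρ
  have hk := Real.sqrt_pos.2 hm
  have hphi : phi2 s v ρ ≤ (2 * Real.pi)⁻¹ * gaussKernel s * (1 * (√m)⁻¹) := by
    rw [phi2_eq_marginal_mul_conditional hρ0]
    have := gaussKernel_nonneg s
    have := gaussKernel_le_one ((v - ρ * s) / √(1 - ρ ^ 2))
    gcongr
  have hnum : |ρ * v - s| ≤ |v| + |s| := by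
    have hρ1 : |ρ| ≤ 1 := (sq_le_one_iff_abs_le_one ρ).1 (by linarith)
    calc |ρ * v - s| ≤ |ρ * v| + |s| := abs_sub _ _
      _ ≤ |v| + |s| := by
        rw [abs_mul]
        gcongr
        exact mul_le_of_le_one_left (abs_nonneg v) hρ1
  rw [abs_mul, abs_div, abs_of_pos hρ0, abs_of_pos (phi2_pos hρ0 s v)]
  calc phi2 s v ρ * (|ρ * v - s| / (1 - ρ ^ 2))
      ≤ ((2 * Real.pi)⁻¹ * gaussKernel s * (1 * (√m)⁻¹)) * ((|v| + |s|) / m) := by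
        have := (phi2_pos hρ0 s v).le
        gcongr
        exact this.trans hphi
    _ = _ := by ring

lemma integrable_marginal_mul_gaussCDF {ρ : ℝ} (v : ℝ) :
    Integrable
      (fun s => (2 * Real.pi)⁻¹ * gaussKernel s * gaussCDF ((v - ρ * s) / √(1 - ρ ^ 2))) := by
  refine (integrable_gaussKernel.const_mul _).mul_bdd (c := ∫ t, gaussKernel t) ?_ ?_
  · exact (continuous_gaussCDF.comp (by fun_prop)).aestronglyMeasurable
  · refine Eventually.of_forall fun s => ?_
    rw [Real.norm_of_nonneg (gaussCDF_nonneg _)]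
    exact gaussCDF_le _

/-- Plackett's identity: the derivative of the distribution function in the correlation is
the density. -/
lemma hasDerivAt_Phi2 {ρ : ℝ} (hρ : 0 < 1 - ρ ^ 2) (u v : ℝ) :
    HasDerivAt (fun r => Phi2 u v r) (phi2 u v ρ) ρ := by
  set m := (1 - ρ ^ 2) / 2 with hm
  have hm0 : 0 < m := half_pos hρ
  have hnhds : {r : ℝ | m < 1 - r ^ 2} ∈ 𝓝 ρ :=
    (isOpen_lt continuous_const (by fun_prop)).mem_nhds (half_lt_self hρ)
  have hcont (r : ℝ) : Continuous fun s =>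
      (2 * Real.pi)⁻¹ * gaussKernel s * gaussCDF ((v - r * s) / √(1 - r ^ 2)) :=
    (continuous_const.mul continuous_gaussKernel).mul (continuous_gaussCDF.comp (by fun_prop))
  have hcont' : Continuous fun s => phi2 s v ρ * ((ρ * v - s) / (1 - ρ ^ 2)) := by
    unfold phi2; fun_prop
  obtain ⟨hint, hderiv⟩ := hasDerivAt_integral_of_dominated_loc_of_deriv_le
    (μ := volume.restrict (Iic u))
    (F := fun r s => (2 * Real.pi)⁻¹ * gaussKernel s * gaussCDF ((v - r * s) / √(1 - r ^ 2)))
    (F' := fun r s => phi2 s v r * ((r * v - s) / (1 - r ^ 2)))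
    (bound := fun s =>
      (2 * Real.pi)⁻¹ * (√m)⁻¹ * m⁻¹ * (|v| * gaussKernel s + |s| * gaussKernel s))
    hnhds (Eventually.of_forall fun r => (hcont r).aestronglyMeasurable)
    (integrable_marginal_mul_gaussCDF v).integrableOn hcont'.aestronglyMeasurable
    (Eventually.of_forall fun s r hr => abs_phi2_mul_le hm0 (le_of_lt hr) s v)
    (((integrable_gaussKernel.const_mul _).add integrable_abs_mul_gaussKernel).const_mul
      _).integrableOn
    (Eventually.of_forall fun s r hr => hasDerivAt_marginal_mul_gaussCDF (hm0.trans hr) s v)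
  rw [integral_Iic_of_hasDerivAt_of_tendsto' (fun s _ => hasDerivAt_phi2_left hρ s v) hint
    (tendsto_phi2_left_atBot hρ v), sub_zero] at hderiv
  refine hderiv.congr_of_eventuallyEq ?_
  filter_upwards [hnhds] with r hr
  simp_rw [Phi2, integral_Iic_phi2 (hm0.trans hr)]

/-- for fixed `u, v`, the map `ρ ↦ Φ₂(u,v;ρ)` is strictly increasing
on `(-1,1)`. -/
theorem Phi2_strictMonoOn_rho (u v : ℝ) :
    StrictMonoOn (fun ρ => Phi2 u v ρ) (Set.Ioo (-1 : ℝ) 1) := by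
  have hpos {ρ : ℝ} (h : ρ ∈ Ioo (-1 : ℝ) 1) : 0 < 1 - ρ ^ 2 := by
    nlinarith [h.1, h.2]
  refine strictMonoOn_of_deriv_pos (convex_Ioo _ _)
    (fun ρ h => (hasDerivAt_Phi2 (hpos h) u v).continuousAt.continuousWithinAt) fun ρ h => ?_
  rw [interior_Ioo] at h
  rw [(hasDerivAt_Phi2 (hpos h) u v).deriv]
  exact phi2_pos (hpos h) u v
end

section
/- (Identifiability of the polychoric model) Let θ = (ρ, a₁,...,a_{K_X−1}, b₁,...,b_{K_Y−1}) and θ' = (ρ', a'₁,...,a'_{K_X−1}, b'₁,...,b'_{K_Y−1}) be two admissible parameter vectors of the polychoric model with the same numbers of response categories K_X ≥ 2 and K_Y ≥ 2. If p(x,y;θ) = p(x,y;θ') for all x ∈ {1,...,K_X} and y ∈ {1,...,K_Y}, then θ = θ', i.e., ρ = ρ', a_k = a'_k for all k, and b_l = b'_l for all l. -/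
open MeasureTheory Real

/-- The interval `[a_{x-1}, a_x)` of the real line corresponding to category `x ∈ {1,…,K}`
for thresholds `a₁ < … < a_{K-1}`, with the conventions `a₀ = -∞` and `a_K = +∞`
(encoded by dropping the corresponding bound). -/
def cellSet (K : ℕ) (a : ℕ → ℝ) (x : ℕ) : Set ℝ :=
  {s : ℝ | (1 < x → a (x - 1) ≤ s) ∧ (x < K → s < a x)}

/-- Cell probability `p(x,y;θ)` of the polychoric model:
`∫_{a_{x-1}}^{a_x} ∫_{b_{y-1}}^{b_y} φ₂(s,t;ρ) dt ds`. -/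
noncomputable def cellProb (KX KY : ℕ) (ρ : ℝ) (a b : ℕ → ℝ) (x y : ℕ) : ℝ :=
  ∫ s in cellSet KX a x, ∫ t in cellSet KY b y, phi2 s t ρ

open ProbabilityTheory

/-- Cumulative distribution function of the standard normal distribution. -/
noncomputable def stdNormalCdf (c : ℝ) : ℝ := (gaussianReal 0 1).real (Set.Iio c)

theorem stdNormalCdf_eq_integral (c : ℝ) :
    stdNormalCdf c = ∫ s in Set.Iio c, gaussianPDFReal 0 1 s := by
  rw [stdNormalCdf, measureReal_def, gaussianReal_apply_eq_integral _ one_ne_zero,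
    ENNReal.toReal_ofReal (setIntegral_nonneg measurableSet_Iio
      fun s _ => gaussianPDFReal_nonneg _ _ s)]

theorem stdNormalCdf_strictMono : StrictMono stdNormalCdf := by
  intro c d hcd
  have hpos : (gaussianReal 0 1) (Set.Ico c d) ≠ 0 := by
    intro h
    have := gaussianReal_absolutelyContinuous' 0 one_ne_zero h
    simp at this
    linarith
  have hpos' : 0 < (gaussianReal 0 1).real (Set.Ico c d) :=
    ENNReal.toReal_pos hpos (measure_ne_top _ _)
  have hdisj : Disjoint (Set.Iio c) (Set.Ico c d) :=
    Set.disjoint_left.2 fun s h h' => absurd h (not_lt.2 h'.1)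
  rw [stdNormalCdf, stdNormalCdf, ← Set.Iio_union_Ico_eq_Iio hcd.le,
    measureReal_union hdisj measurableSet_Ico]
  linarith

/-- Standardization of a normal distribution function. -/
theorem integral_Iio_gaussianPDFReal (m σ b : ℝ) (hσ : 0 < σ) (v : NNReal)
    (hv : (v : ℝ) = σ ^ 2) :
    ∫ t in Set.Iio b, gaussianPDFReal m v t = stdNormalCdf ((b - m) / σ) := by
  have hv0 : v ≠ 0 := by
    rintro rfl
    exact (pow_pos hσ 2).ne hv
  have hmap : (gaussianReal 0 1).map (fun z => σ * z + m) = gaussianReal m v := by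
    have h1 := gaussianReal_map_const_mul (μ := 0) (v := 1) σ
    have h2 := gaussianReal_map_add_const (μ := σ * 0) (v := NNReal.mk (σ ^ 2) (sq_nonneg σ) * 1) m
    rw [← h1, Measure.map_map (by fun_prop) (by fun_prop)] at h2
    have hvv : NNReal.mk (σ ^ 2) (sq_nonneg σ) * 1 = v := by
      apply NNReal.eq
      simp [hv]
    rw [hvv] at h2
    simpa [Function.comp_def] using h2
  have hreal : (gaussianReal m v).real (Set.Iio b) = ∫ t in Set.Iio b, gaussianPDFReal m v t := by
    rw [measureReal_def, gaussianReal_apply_eq_integral _ hv0,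
      ENNReal.toReal_ofReal (setIntegral_nonneg measurableSet_Iio
        fun s _ => gaussianPDFReal_nonneg _ _ s)]
  rw [← hreal, ← hmap, map_measureReal_apply (by fun_prop) measurableSet_Iio, stdNormalCdf]
  congr 1
  ext z
  simp only [Set.mem_preimage, Set.mem_Iio]
  rw [lt_div_iff₀ hσ]
  constructor <;> intro h <;> linarith

theorem phi2_symm (u v ρ : ℝ) : phi2 u v ρ = phi2 v u ρ := by
  unfold phi2
  congr 3
  ring

theorem one_sub_sq_pos {ρ : ℝ} (hρ : ρ ∈ Set.Ioo (-1 : ℝ) 1) : 0 < 1 - ρ ^ 2 := by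
  nlinarith [hρ.1, hρ.2]

theorem phi2_eq_mul {ρ : ℝ} (hρ : ρ ∈ Set.Ioo (-1 : ℝ) 1) (u v : ℝ) :
    phi2 u v ρ = gaussianPDFReal 0 1 u *
      gaussianPDFReal (ρ * u) (1 - ρ ^ 2).toNNReal v := by
  have h := one_sub_sq_pos hρ
  rw [gaussianPDFReal, gaussianPDFReal, Real.coe_toNNReal _ h.le, phi2, NNReal.coe_one,
    mul_mul_mul_comm, ← mul_inv, ← Real.exp_add, ← Real.sqrt_mul (by positivity)]
  congr 2
  · rw [show 2 * π * 1 * (2 * π * (1 - ρ ^ 2)) = (2 * π) ^ 2 * (1 - ρ ^ 2) by ring,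
      Real.sqrt_mul (by positivity), Real.sqrt_sq (by positivity)]
  · field_simp
    ring

theorem integral_phi2 {ρ : ℝ} (hρ : ρ ∈ Set.Ioo (-1 : ℝ) 1) (s : ℝ) :
    ∫ t, phi2 s t ρ = gaussianPDFReal 0 1 s := by
  simp_rw [phi2_eq_mul hρ]
  rw [integral_const_mul, integral_gaussianPDFReal_eq_one, mul_one]
  simpa using one_sub_sq_pos hρ

theorem integral_Iio_phi2 {ρ : ℝ} (hρ : ρ ∈ Set.Ioo (-1 : ℝ) 1) (b s : ℝ) :
    ∫ t in Set.Iio b, phi2 s t ρ =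
      gaussianPDFReal 0 1 s * stdNormalCdf ((b - ρ * s) / √(1 - ρ ^ 2)) := by
  have h := one_sub_sq_pos hρ
  simp_rw [phi2_eq_mul hρ]
  rw [integral_const_mul, integral_Iio_gaussianPDFReal _ _ _ (Real.sqrt_pos.2 h)]
  rw [Real.coe_toNNReal _ h.le, Real.sq_sqrt h.le]

theorem integrable_phi2_right {ρ : ℝ} (hρ : ρ ∈ Set.Ioo (-1 : ℝ) 1) (s : ℝ) :
    Integrable fun t => phi2 s t ρ := by
  simp_rw [phi2_eq_mul hρ]
  exact (integrable_gaussianPDFReal _ _).const_mul _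

theorem integrable_uncurry_phi2 {ρ : ℝ} (hρ : ρ ∈ Set.Ioo (-1 : ℝ) 1) :
    Integrable (Function.uncurry fun s t => phi2 s t ρ) (volume.prod volume) := by
  have hcont : Continuous (Function.uncurry fun s t => phi2 s t ρ) := by
    unfold phi2 Function.uncurry
    fun_prop
  refine (integrable_prod_iff hcont.aestronglyMeasurable).2
    ⟨.of_forall fun s => integrable_phi2_right hρ s, ?_⟩
  have hnorm : (fun s => ∫ t, ‖Function.uncurry (fun s t => phi2 s t ρ) (s, t)‖) =
      gaussianPDFReal 0 1 := by
    funext s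
    rw [← integral_phi2 hρ s]
    congr 1
    funext t
    have hnonneg : 0 ≤ phi2 s t ρ := by
      unfold phi2
      positivity
    exact Real.norm_of_nonneg hnonneg
  rw [hnorm]
  exact integrable_gaussianPDFReal _ _

theorem integrable_uncurry_phi2_restrict {ρ : ℝ} (hρ : ρ ∈ Set.Ioo (-1 : ℝ) 1) (A B : Set ℝ) :
    Integrable (Function.uncurry fun s t => phi2 s t ρ)
      ((volume.restrict A).prod (volume.restrict B)) := by
  rw [Measure.prod_restrict]
  exact (integrable_uncurry_phi2 hρ).restrict

theorem integrable_setIntegral_phi2 {ρ : ℝ} (hρ : ρ ∈ Set.Ioo (-1 : ℝ) 1) (B : Set ℝ) :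
    Integrable fun s => ∫ t in B, phi2 s t ρ := by
  have h := integrable_uncurry_phi2_restrict hρ Set.univ B
  rw [Measure.restrict_univ] at h
  exact h.integral_prod_left

theorem cellProb_symm (KX KY : ℕ) {ρ : ℝ} (hρ : ρ ∈ Set.Ioo (-1 : ℝ) 1) (a b : ℕ → ℝ) (x y : ℕ) :
    cellProb KX KY ρ a b x y = cellProb KY KX ρ b a y x := by
  unfold cellProb
  rw [integral_integral_swap (integrable_uncurry_phi2_restrict hρ _ _)]
  simp_rw [phi2_symm]

theorem cellSet_one {K : ℕ} (hK : 2 ≤ K) (a : ℕ → ℝ) : cellSet K a 1 = Set.Iio (a 1) := by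
  ext s
  simp [cellSet, show 1 < K by omega]

theorem cellSet_succ {K : ℕ} (a : ℕ → ℝ) {k : ℕ} (hk : 1 ≤ k) (hkK : k + 1 < K) :
    cellSet K a (k + 1) = Set.Ico (a k) (a (k + 1)) := by
  ext s
  simp [cellSet, hkK, show 0 < k by omega]

theorem cellSet_last (a : ℕ → ℝ) {k : ℕ} (hk : 1 ≤ k) :
    cellSet (k + 1) a (k + 1) = Set.Ici (a k) := by
  ext s
  simp [cellSet, show 0 < k by omega]

theorem sum_setIntegral_cellSet {K : ℕ} (hK : 2 ≤ K) {a : ℕ → ℝ}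
    (ha : ∀ k, 1 ≤ k → k + 1 < K → a k < a (k + 1)) {f : ℝ → ℝ} (hf : Integrable f)
    {k : ℕ} (hk : 1 ≤ k) (hkK : k < K) :
    ∑ x ∈ Finset.Icc 1 k, ∫ s in cellSet K a x, f s = ∫ s in Set.Iio (a k), f s := by
  induction k, hk using Nat.le_induction with
  | base => simp [cellSet_one hK]
  | succ k hk ih =>
    rw [Finset.sum_Icc_succ_top (by omega), ih (by omega), cellSet_succ a hk hkK,
      ← Set.Iio_union_Ico_eq_Iio (ha k hk hkK).le,
      setIntegral_union _ measurableSet_Ico hf.integrableOn hf.integrableOn]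
    exact Set.disjoint_left.2 fun s h h' => absurd h (not_lt.2 h'.1)

theorem sum_setIntegral_cellSet_all {K : ℕ} (hK : 2 ≤ K) {a : ℕ → ℝ}
    (ha : ∀ k, 1 ≤ k → k + 1 < K → a k < a (k + 1)) {f : ℝ → ℝ} (hf : Integrable f) :
    ∑ x ∈ Finset.Icc 1 K, ∫ s in cellSet K a x, f s = ∫ s, f s := by
  obtain ⟨k, rfl⟩ : ∃ k, K = k + 1 := ⟨K - 1, by omega⟩
  rw [Finset.sum_Icc_succ_top (by omega),
    sum_setIntegral_cellSet hK ha hf (by omega) (by omega), cellSet_last a (by omega),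
    ← Set.compl_Iio]
  exact integral_add_compl measurableSet_Iio hf

/-- The cell probabilities of the categories up to `k` of the first variable add up to its
marginal distribution function. -/
theorem sum_cellProb {KX KY : ℕ} (hKX : 2 ≤ KX) (hKY : 2 ≤ KY) {ρ : ℝ}
    (hρ : ρ ∈ Set.Ioo (-1 : ℝ) 1) {a b : ℕ → ℝ}
    (ha : ∀ k, 1 ≤ k → k + 1 < KX → a k < a (k + 1))
    (hb : ∀ l, 1 ≤ l → l + 1 < KY → b l < b (l + 1)) {k : ℕ} (hk : 1 ≤ k) (hkK : k < KX) :
    ∑ x ∈ Finset.Icc 1 k, ∑ y ∈ Finset.Icc 1 KY, cellProb KX KY ρ a b x y =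
      stdNormalCdf (a k) := by
  rw [stdNormalCdf_eq_integral,
    ← sum_setIntegral_cellSet hKX ha (integrable_gaussianPDFReal 0 1) hk hkK]
  refine Finset.sum_congr rfl fun x _ => ?_
  unfold cellProb
  rw [← integral_finsetSum _ fun y _ => (integrable_setIntegral_phi2 hρ _).restrict]
  simp_rw [sum_setIntegral_cellSet_all hKY hb (integrable_phi2_right hρ _), integral_phi2 hρ]

theorem threshold_eq {KX KY : ℕ} (hKX : 2 ≤ KX) (hKY : 2 ≤ KY) {ρ ρ' : ℝ}
    (hρ : ρ ∈ Set.Ioo (-1 : ℝ) 1) (hρ' : ρ' ∈ Set.Ioo (-1 : ℝ) 1) {a b a' b' : ℕ → ℝ}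
    (ha : ∀ k, 1 ≤ k → k + 1 < KX → a k < a (k + 1))
    (hb : ∀ l, 1 ≤ l → l + 1 < KY → b l < b (l + 1))
    (ha' : ∀ k, 1 ≤ k → k + 1 < KX → a' k < a' (k + 1))
    (hb' : ∀ l, 1 ≤ l → l + 1 < KY → b' l < b' (l + 1))
    (heq : ∀ x ∈ Finset.Icc 1 KX, ∀ y ∈ Finset.Icc 1 KY,
      cellProb KX KY ρ a b x y = cellProb KX KY ρ' a' b' x y)
    {k : ℕ} (hk : 1 ≤ k) (hkK : k < KX) : a k = a' k := by
  apply stdNormalCdf_strictMono.injective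
  rw [← sum_cellProb hKX hKY hρ ha hb hk hkK, ← sum_cellProb hKX hKY hρ' ha' hb' hk hkK]
  refine Finset.sum_congr rfl fun x hx => Finset.sum_congr rfl fun y hy => heq x ?_ y hy
  rw [Finset.mem_Icc] at hx ⊢
  omega

theorem mul_sqrt_one_sub_sq_lt {ρ ρ' : ℝ} (hρ : ρ ∈ Set.Ioo (-1 : ℝ) 1)
    (hρ' : ρ' ∈ Set.Ioo (-1 : ℝ) 1) (hlt : ρ < ρ') :
    ρ * √(1 - ρ' ^ 2) < ρ' * √(1 - ρ ^ 2) := by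
  have h := one_sub_sq_pos hρ
  have h' := one_sub_sq_pos hρ'
  have hs := Real.sqrt_pos.2 h
  have hs' := Real.sqrt_pos.2 h'
  have e := Real.sq_sqrt h.le
  have e' := Real.sq_sqrt h'.le
  rcases le_or_gt 0 ρ with h0 | h0
  · refine lt_of_pow_lt_pow_left₀ 2 (by nlinarith) ?_
    rw [mul_pow, mul_pow, e, e']
    nlinarith
  rcases le_or_gt 0 ρ' with h1 | h1
  · nlinarith
  · suffices -ρ' * √(1 - ρ ^ 2) < -ρ * √(1 - ρ' ^ 2) by linarith
    refine lt_of_pow_lt_pow_left₀ 2 (by nlinarith) ?_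
    rw [mul_pow, mul_pow, e, e']
    nlinarith

theorem setIntegral_pos_of_forall_pos {f : ℝ → ℝ} {A : Set ℝ} (hA : MeasurableSet A)
    (hA0 : 0 < volume A) (hf : Integrable f) (hpos : ∀ s ∈ A, 0 < f s) :
    0 < ∫ s in A, f s := by
  rw [setIntegral_pos_iff_support_of_nonneg_ae
    ((ae_restrict_iff' hA).2 (.of_forall fun s hs => (hpos s hs).le)) hf.integrableOn]
  have hsub : A ⊆ Function.support f := fun s hs => (hpos s hs).ne'
  rwa [Set.inter_eq_right.2 hsub]

/-- The bivariate normal distribution function is strictly increasing in the correlation: the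
conditional distribution functions for two correlations cross exactly once, and they have the same
mean. -/
theorem integral_Iio_Iio_phi2_lt {ρ ρ' : ℝ} (hρ : ρ ∈ Set.Ioo (-1 : ℝ) 1)
    (hρ' : ρ' ∈ Set.Ioo (-1 : ℝ) 1) (hlt : ρ < ρ') (a b : ℝ) :
    ∫ s in Set.Iio a, ∫ t in Set.Iio b, phi2 s t ρ <
      ∫ s in Set.Iio a, ∫ t in Set.Iio b, phi2 s t ρ' := by
  have htotal : ∀ {r : ℝ}, r ∈ Set.Ioo (-1 : ℝ) 1 →
      ∫ s, ∫ t in Set.Iio b, phi2 s t r = stdNormalCdf b := by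
    intro r hr
    have h := integrable_uncurry_phi2_restrict hr Set.univ (Set.Iio b)
    rw [Measure.restrict_univ] at h
    rw [integral_integral_swap h, stdNormalCdf_eq_integral]
    simp_rw [fun s t => phi2_symm s t r, integral_phi2 hr]
  have hi := integrable_setIntegral_phi2 hρ (Set.Iio b)
  have hi' := integrable_setIntegral_phi2 hρ' (Set.Iio b)
  have hσ := Real.sqrt_pos.2 (one_sub_sq_pos hρ)
  have hσ' := Real.sqrt_pos.2 (one_sub_sq_pos hρ')
  have hq := sub_pos.2 (mul_sqrt_one_sub_sq_lt hρ hρ' hlt)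
  set q := ρ' * √(1 - ρ ^ 2) - ρ * √(1 - ρ' ^ 2) with hq_def
  set c := b * (√(1 - ρ ^ 2) - √(1 - ρ' ^ 2)) / q with hc_def
  have hcq : c * q = b * (√(1 - ρ ^ 2) - √(1 - ρ' ^ 2)) := div_mul_cancel₀ _ hq.ne'
  have hleft : ∀ s < c, ∫ t in Set.Iio b, phi2 s t ρ < ∫ t in Set.Iio b, phi2 s t ρ' := by
    intro s hs
    rw [integral_Iio_phi2 hρ, integral_Iio_phi2 hρ']
    refine mul_lt_mul_of_pos_left (stdNormalCdf_strictMono ?_)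
      (gaussianPDFReal_pos _ _ _ one_ne_zero)
    rw [div_lt_div_iff₀ hσ hσ']
    nlinarith [mul_lt_mul_of_pos_right hs hq]
  have hright : ∀ s, c < s → ∫ t in Set.Iio b, phi2 s t ρ' < ∫ t in Set.Iio b, phi2 s t ρ := by
    intro s hs
    rw [integral_Iio_phi2 hρ, integral_Iio_phi2 hρ']
    refine mul_lt_mul_of_pos_left (stdNormalCdf_strictMono ?_)
      (gaussianPDFReal_pos _ _ _ one_ne_zero)
    rw [div_lt_div_iff₀ hσ' hσ]
    nlinarith [mul_lt_mul_of_pos_right hs hq]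
  rcases le_or_gt a c with hac | hac
  · have := setIntegral_pos_of_forall_pos (measurableSet_Iio (a := a)) (by simp) (hi'.sub hi)
      fun s hs => sub_pos.2 (hleft s (lt_of_lt_of_le hs hac))
    simp only [Pi.sub_apply] at this
    rw [integral_sub hi'.restrict hi.restrict] at this
    linarith
  · have := setIntegral_pos_of_forall_pos (measurableSet_Ici (a := a)) (by simp) (hi.sub hi')
      fun s hs => sub_pos.2 (hright s (lt_of_lt_of_le hac hs))
    simp only [Pi.sub_apply] at this
    rw [integral_sub hi.restrict hi'.restrict] at this
    have h := integral_add_compl (measurableSet_Iio (a := a)) hi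
    have h' := integral_add_compl (measurableSet_Iio (a := a)) hi'
    rw [Set.compl_Iio, htotal hρ] at h
    rw [Set.compl_Iio, htotal hρ'] at h'
    linarith

/-- identifiability of the polychoric model: if two admissible parameter
vectors induce the same cell probabilities on the whole contingency table, then they are
equal: the correlations agree and all thresholds agree. -/
theorem polychoric_identifiable (KX KY : ℕ) (hKX : 2 ≤ KX) (hKY : 2 ≤ KY)
    (ρ ρ' : ℝ) (hρ : ρ ∈ Set.Ioo (-1 : ℝ) 1) (hρ' : ρ' ∈ Set.Ioo (-1 : ℝ) 1)
    (a b a' b' : ℕ → ℝ)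
    (ha : ∀ k, 1 ≤ k → k + 1 < KX → a k < a (k + 1))
    (hb : ∀ l, 1 ≤ l → l + 1 < KY → b l < b (l + 1))
    (ha' : ∀ k, 1 ≤ k → k + 1 < KX → a' k < a' (k + 1))
    (hb' : ∀ l, 1 ≤ l → l + 1 < KY → b' l < b' (l + 1))
    (heq : ∀ x ∈ Finset.Icc 1 KX, ∀ y ∈ Finset.Icc 1 KY,
      cellProb KX KY ρ a b x y = cellProb KX KY ρ' a' b' x y) :
    ρ = ρ' ∧ (∀ k, 1 ≤ k → k < KX → a k = a' k) ∧ (∀ l, 1 ≤ l → l < KY → b l = b' l) := by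
  have hA : ∀ k, 1 ≤ k → k < KX → a k = a' k := fun k hk hkK =>
    threshold_eq hKX hKY hρ hρ' ha hb ha' hb' heq hk hkK
  have hB : ∀ l, 1 ≤ l → l < KY → b l = b' l := fun l hl hlK =>
    threshold_eq hKY hKX hρ hρ' hb ha hb' ha'
      (fun y hy x hx => by
        rw [cellProb_symm KY KX hρ, cellProb_symm KY KX hρ']
        exact heq x hx y hy) hl hlK
  refine ⟨?_, hA, hB⟩
  have h := heq 1 (Finset.mem_Icc.2 ⟨le_rfl, by omega⟩) 1 (Finset.mem_Icc.2 ⟨le_rfl, by omega⟩)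
  simp only [cellProb, cellSet_one hKX, cellSet_one hKY] at h
  rw [← hA 1 le_rfl (by omega), ← hB 1 le_rfl (by omega)] at h
  rcases lt_trichotomy ρ ρ' with hlt | heq' | hlt
  · exact absurd h (integral_Iio_Iio_phi2_lt hρ hρ' hlt _ _).ne
  · exact heq'
  · exact absurd h (integral_Iio_Iio_phi2_lt hρ' hρ hlt _ _).ne'
end
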